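/- Fix x ∈ 𝒳 with P(X = x) > 0 and suppose: (Randomization) under P(·|S = e, X = x), D is independent of the pair (Y(0), Y(1)); (Positivity) P(S = e, X = x, D = d, Y = y) > 0 and P(S = o, X = x, Y = y) > 0 for all d, y ∈ {0, 1}; (Stability) R is conditionally independent of S given (X, D, Y); (No direct effect) R is conditionally independent of D given (X, Y). Define, as random variables, Δᵉ := 1{D = 1, S = e}/P(D = 1, S = e | X = x) − 1{D = 0, S = e}/P(D = 0, S = e | X = x) and Δᵒ := 1{Y = 1, S = o}/P(Y = 1, S = o | X = x) − 1{Y = 0, S = o}/P(Y = 0, S = o | X = x), and let θ(x) := E[Y(1) − Y(0) | S = e, X = x]. Then the conditional expectation of Δᵉ − θ(x)·Δᵒ given σ(R), computed under the measure P_x := P(·|X = x), equals 0 P_x-almost surely. -/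

import Mathlib

open MeasureTheory ProbabilityTheory

noncomputable section

/-- Sample indicator values: experimental (`e`) or observational (`o`). -/
inductive Sample : Type
  | e
  | o
deriving DecidableEq

instance : MeasurableSpace Sample := ⊤

/-- Real-valued indicator of a boolean (`{0,1}`-valued variable). -/
def b2r (b : Bool) : ℝ := if b then 1 else 0

/-- `CondIndepOf P R V W` : the conditional law of `R` given `V = v, W = w` agrees with
the conditional law of `R` given `V = v`, for all values with positive probability;
this is the notion of "R is conditionally independent of W given V" for variables with
countable ranges. -/
def CondIndepOf {Ω 𝓡 V W : Type*} [MeasurableSpace Ω] [MeasurableSpace 𝓡]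
    (P : Measure Ω) (R : Ω → 𝓡) (Vf : Ω → V) (Wf : Ω → W) : Prop :=
  ∀ v w, 0 < P {ω | Vf ω = v ∧ Wf ω = w} →
    (P[|{ω | Vf ω = v ∧ Wf ω = w}]).map R = (P[|{ω | Vf ω = v}]).map R

theorem cond_real_apply {Ω : Type*} [MeasurableSpace Ω] {P : Measure Ω} {A : Set Ω}
    (hA : MeasurableSet A) (B : Set Ω) :
    (P[|A]).real B = (P.real A)⁻¹ * P.real (A ∩ B) := by
  rw [measureReal_def, cond_apply hA, ENNReal.toReal_mul, ENNReal.toReal_inv]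
  rfl

/-- If `R` has the same law given `A` and given `C`, then `P (A ∩ R ⁻¹' B)` factors through the
law of `R` given `C`. -/
theorem measureReal_inter_preimage_of_map_cond_eq {Ω 𝓡 : Type*} [MeasurableSpace Ω]
    [MeasurableSpace 𝓡] {P : Measure Ω} [IsFiniteMeasure P] {R : Ω → 𝓡} (hR : Measurable R)
    {A C : Set Ω} (hA : MeasurableSet A)
    (h : 0 < P A → (P[|A]).map R = (P[|C]).map R) {B : Set 𝓡} (hB : MeasurableSet B) :
    P.real (A ∩ R ⁻¹' B) = P.real A * (P[|C]).real (R ⁻¹' B) := by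
  rcases eq_or_ne (P A) 0 with h0 | h0
  · have h1 : P (A ∩ R ⁻¹' B) = 0 := measure_mono_null Set.inter_subset_left h0
    simp [measureReal_def, h0, h1]
  · have h2 : (P[|A]).real (R ⁻¹' B) = (P[|C]).real (R ⁻¹' B) := by
      rw [measureReal_def, measureReal_def, ← Measure.map_apply hR hB, ← Measure.map_apply hR hB,
        h (pos_iff_ne_zero.2 h0)]
    rw [← h2, cond_real_apply hA]
    have h3 : P.real A ≠ 0 := (measureReal_ne_zero_iff).2 h0
    field_simp

/-- Splitting an event according to the value of a Boolean variable. -/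
theorem measureReal_eq_add_bool {Ω : Type*} [MeasurableSpace Ω] {P : Measure Ω}
    [IsFiniteMeasure P] {Y : Ω → Bool} (hY : Measurable Y) (A : Set Ω) :
    P.real A = P.real (A ∩ {ω | Y ω = true}) + P.real (A ∩ {ω | Y ω = false}) := by
  have hm : MeasurableSet {ω | Y ω = true} := hY (measurableSet_singleton true)
  rw [← measureReal_inter_add_sdiff (s := A) hm]
  congr 2
  ext ω
  simp

/-- Under independence of `D` and `(Y0, Y1)`, the effect of `D` on `Y` is the difference of the
conditional probabilities of `Y` given the two values of `D`. -/
theorem integral_b2r_sub_eq {Ω : Type*} [MeasurableSpace Ω] {μ : Measure Ω}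
    [IsFiniteMeasure μ] {D Y0 Y1 Y : Ω → Bool} (hY0 : Measurable Y0)
    (hY1 : Measurable Y1) (hYdef : ∀ ω, Y ω = if D ω then Y1 ω else Y0 ω)
    (hind : IndepFun D (fun ω => (Y0 ω, Y1 ω)) μ)
    (h1 : μ.real {ω | D ω = true} ≠ 0) (h0 : μ.real {ω | D ω = false} ≠ 0) :
    ∫ ω, (b2r (Y1 ω) - b2r (Y0 ω)) ∂μ =
      μ.real {ω | D ω = true ∧ Y ω = true} / μ.real {ω | D ω = true} -
        μ.real {ω | D ω = false ∧ Y ω = true} / μ.real {ω | D ω = false} := by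
  have hint : ∀ {Z : Ω → Bool}, Measurable Z → Integrable (fun ω => b2r (Z ω)) μ ∧
      ∫ ω, b2r (Z ω) ∂μ = μ.real {ω | Z ω = true} := by
    intro Z hZ
    have hm : MeasurableSet {ω | Z ω = true} := hZ (measurableSet_singleton true)
    have he : (fun ω => b2r (Z ω)) = {ω | Z ω = true}.indicator 1 := by
      ext ω
      simp [b2r, Set.indicator]
    rw [he]
    exact ⟨(integrable_const (1 : ℝ)).indicator hm, integral_indicator_one hm⟩
  have hprod : ∀ (d : Bool) (T : Set (Bool × Bool)),
      μ.real ({ω | D ω = d} ∩ {ω | (Y0 ω, Y1 ω) ∈ T}) =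
        μ.real {ω | D ω = d} * μ.real {ω | (Y0 ω, Y1 ω) ∈ T} := by
    intro d T
    have h := hind.measure_inter_preimage_eq_mul {d} T (measurableSet_singleton d)
      (Set.toFinite T).measurableSet
    rw [measureReal_def, measureReal_def, measureReal_def, ← ENNReal.toReal_mul]
    exact congrArg ENNReal.toReal h
  have e1 : {ω | D ω = true ∧ Y ω = true} =
      {ω | D ω = true} ∩ {ω | (Y0 ω, Y1 ω) ∈ {p : Bool × Bool | p.2 = true}} := by
    ext ω
    simp +contextual [hYdef]
  have e0 : {ω | D ω = false ∧ Y ω = true} =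
      {ω | D ω = false} ∩ {ω | (Y0 ω, Y1 ω) ∈ {p : Bool × Bool | p.1 = true}} := by
    ext ω
    simp +contextual [hYdef]
  rw [integral_sub (hint hY1).1 (hint hY0).1, (hint hY1).2, (hint hY0).2, e1, e0, hprod, hprod,
    mul_div_cancel_left₀ _ h1, mul_div_cancel_left₀ _ h0]
  rfl

/-- **Theorem (Identification as conditional moment), binary outcome.**
The conditional moment `E_{P_x}[Δᵉ − θ(x)·Δᵒ | σ(R)] = 0` holds `P_x`-a.s., where
`P_x = P(·|X = x)`. -/
theorem statement1
    {Ω 𝓡 𝓧 : Type*} [MeasurableSpace Ω] [MeasurableSpace 𝓡] [StandardBorelSpace 𝓡]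
    [MeasurableSpace 𝓧] [MeasurableSingletonClass 𝓧] [Countable 𝓧]
    (P : Measure Ω) [IsProbabilityMeasure P]
    (S : Ω → Sample) (D : Ω → Bool) (Y0 Y1 : Ω → Bool) (R : Ω → 𝓡) (X : Ω → 𝓧)
    (hS : Measurable S) (hD : Measurable D) (hY0 : Measurable Y0) (hY1 : Measurable Y1)
    (hR : Measurable R) (hX : Measurable X)
    (Y : Ω → Bool) (hYdef : ∀ ω, Y ω = if D ω then Y1 ω else Y0 ω)
    (x : 𝓧) (hx : 0 < P {ω | X ω = x})
    -- Randomization: D ⫫ (Y(0), Y(1)) under P(·|S = e, X = x)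
    (randomization :
      IndepFun D (fun ω => (Y0 ω, Y1 ω)) (P[|{ω | S ω = Sample.e ∧ X ω = x}]))
    -- Positivity
    (positivity_e : ∀ d y : Bool,
      0 < P {ω | S ω = Sample.e ∧ X ω = x ∧ D ω = d ∧ Y ω = y})
    (positivity_o : ∀ y : Bool,
      0 < P {ω | S ω = Sample.o ∧ X ω = x ∧ Y ω = y})
    -- Stability: R ⫫ S | (X, D, Y)
    (stability : CondIndepOf P R (fun ω => (X ω, D ω, Y ω)) S)
    -- No direct effect: R ⫫ D | (X, Y)
    (noDirectEffect : CondIndepOf P R (fun ω => (X ω, Y ω)) D)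
    -- θ(x) := E[Y(1) − Y(0) | S = e, X = x]
    (θx : ℝ)
    (hθx : θx = ∫ ω, (b2r (Y1 ω) - b2r (Y0 ω))
        ∂(P[|{ω | S ω = Sample.e ∧ X ω = x}]))
    -- Δᵉ := 1{D=1,S=e}/P(D=1,S=e|X=x) − 1{D=0,S=e}/P(D=0,S=e|X=x)
    (Δe : Ω → ℝ)
    (hΔe : ∀ ω, Δe ω =
      (if D ω = true ∧ S ω = Sample.e then (1 : ℝ) else 0) /
        ((P[|{ω' | X ω' = x}]) {ω' | D ω' = true ∧ S ω' = Sample.e}).toReal -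
      (if D ω = false ∧ S ω = Sample.e then (1 : ℝ) else 0) /
        ((P[|{ω' | X ω' = x}]) {ω' | D ω' = false ∧ S ω' = Sample.e}).toReal)
    -- Δᵒ := 1{Y=1,S=o}/P(Y=1,S=o|X=x) − 1{Y=0,S=o}/P(Y=0,S=o|X=x)
    (Δo : Ω → ℝ)
    (hΔo : ∀ ω, Δo ω =
      (if Y ω = true ∧ S ω = Sample.o then (1 : ℝ) else 0) /
        ((P[|{ω' | X ω' = x}]) {ω' | Y ω' = true ∧ S ω' = Sample.o}).toReal -
      (if Y ω = false ∧ S ω = Sample.o then (1 : ℝ) else 0) /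
        ((P[|{ω' | X ω' = x}]) {ω' | Y ω' = false ∧ S ω' = Sample.o}).toReal) :
    (P[|{ω | X ω = x}])[(fun ω => Δe ω - θx * Δo ω) |
        MeasurableSpace.comap R inferInstance]
      =ᵐ[P[|{ω | X ω = x}]] 0 := by
  have hSm : ∀ s, MeasurableSet {ω | S ω = s} := fun s => hS (measurableSet_singleton s)
  have hDm : ∀ d, MeasurableSet {ω | D ω = d} := fun d => hD (measurableSet_singleton d)
  have hXm : MeasurableSet {ω | X ω = x} := hX (measurableSet_singleton x)
  have hY : Measurable Y := by
    rw [funext hYdef]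
    exact Measurable.ite (hDm true) hY1 hY0
  have hYm : ∀ y, MeasurableSet {ω | Y ω = y} := fun y => hY (measurableSet_singleton y)
  set Q := P[|{ω | X ω = x}] with hQ
  have hx0 : P.real {ω | X ω = x} ≠ 0 := (measureReal_ne_zero_iff).2 hx.ne'
  set q : Sample → Bool → Bool → ℝ :=
    fun s d y => Q.real {ω | S ω = s ∧ D ω = d ∧ Y ω = y} with hq
  set ν : Bool → Set 𝓡 → ℝ :=
    fun y B => (P[|{ω | (X ω, Y ω) = (x, y)}]).real (R ⁻¹' B) with hν
  have hfac : ∀ s d y (B : Set 𝓡), MeasurableSet B →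
      Q.real ({ω | S ω = s ∧ D ω = d ∧ Y ω = y} ∩ R ⁻¹' B) = q s d y * ν y B := by
    intro s d y B hB
    have hset : {ω | (X ω, D ω, Y ω) = (x, d, y) ∧ S ω = s} =
        {ω | X ω = x} ∩ {ω | S ω = s ∧ D ω = d ∧ Y ω = y} := by
      ext ω
      simp only [Set.mem_ofPred_eq, Prod.mk.injEq, Set.mem_inter_iff]
      tauto
    have hm : MeasurableSet ({ω | X ω = x} ∩ {ω | S ω = s ∧ D ω = d ∧ Y ω = y}) :=
      hXm.inter ((hSm s).inter ((hDm d).inter (hYm y)))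
    have hlaw : 0 < P ({ω | X ω = x} ∩ {ω | S ω = s ∧ D ω = d ∧ Y ω = y}) →
        (P[|({ω | X ω = x} ∩ {ω | S ω = s ∧ D ω = d ∧ Y ω = y})]).map R =
          (P[|{ω | (X ω, Y ω) = (x, y)}]).map R := by
      intro hpos
      rw [← hset] at hpos ⊢
      rw [stability (x, d, y) s hpos]
      have hset' : {ω | (X ω, D ω, Y ω) = (x, d, y)} =
          {ω | (X ω, Y ω) = (x, y) ∧ D ω = d} := by
        ext ω
        simp only [Set.mem_ofPred_eq, Prod.mk.injEq]
        tauto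
      rw [hset']
      refine noDirectEffect (x, y) d (hpos.trans_le (measure_mono ?_))
      rw [← hset']
      exact fun ω hω => hω.1
    have h := measureReal_inter_preimage_of_map_cond_eq hR hm hlaw hB
    simp only [hq, hQ, hν]
    rw [cond_real_apply hXm, cond_real_apply hXm, ← Set.inter_assoc, h, mul_assoc]
  have hsplitY : ∀ (d : Bool) (B : Set 𝓡), MeasurableSet B → ∀ s,
      Q.real ({ω | D ω = d ∧ S ω = s} ∩ R ⁻¹' B) =
        q s d true * ν true B + q s d false * ν false B := by
    intro d B hB s
    rw [measureReal_eq_add_bool hY, ← hfac _ _ _ _ hB, ← hfac _ _ _ _ hB]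
    congr 2 <;> · ext ω; simp only [Set.mem_ofPred_eq, Set.mem_inter_iff]; tauto
  have hsplitD : ∀ (y : Bool) (B : Set 𝓡), MeasurableSet B → ∀ s,
      Q.real ({ω | Y ω = y ∧ S ω = s} ∩ R ⁻¹' B) =
        (q s true y + q s false y) * ν y B := by
    intro y B hB s
    rw [measureReal_eq_add_bool hD, add_mul, ← hfac _ _ _ _ hB, ← hfac _ _ _ _ hB]
    congr 2 <;> · ext ω; simp only [Set.mem_ofPred_eq, Set.mem_inter_iff]; tauto
  have hmargD : ∀ d s, Q.real {ω | D ω = d ∧ S ω = s} = q s d true + q s d false := by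
    intro d s
    rw [measureReal_eq_add_bool hY]
    congr 2 <;> · ext ω; simp only [Set.mem_ofPred_eq, Set.mem_inter_iff]; tauto
  have hmargY : ∀ y s, Q.real {ω | Y ω = y ∧ S ω = s} = q s true y + q s false y := by
    intro y s
    rw [measureReal_eq_add_bool hD]
    congr 2 <;> · ext ω; simp only [Set.mem_ofPred_eq, Set.mem_inter_iff]; tauto
  have hQpos : ∀ A : Set Ω, 0 < P ({ω | X ω = x} ∩ A) → 0 < Q.real A := by
    intro A hA
    rw [hQ, cond_real_apply hXm]
    exact mul_pos (inv_pos.2 (lt_of_le_of_ne measureReal_nonneg hx0.symm))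
      (ENNReal.toReal_pos hA.ne' (measure_ne_top _ _))
  have hqe : ∀ d y, 0 < q Sample.e d y := by
    intro d y
    refine hQpos _ ((positivity_e d y).trans_le (measure_mono ?_))
    rintro ω ⟨h1, h2, h3, h4⟩
    exact ⟨h2, h1, h3, h4⟩
  have hqo : ∀ y, 0 < q Sample.o true y + q Sample.o false y := by
    intro y
    rw [← hmargY]
    refine hQpos _ ((positivity_o y).trans_le (measure_mono ?_))
    rintro ω ⟨h1, h2, h3⟩
    exact ⟨h2, h3, h1⟩
  have hθ : θx = q Sample.e true true / (q Sample.e true true + q Sample.e true false) -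
      q Sample.e false true / (q Sample.e false true + q Sample.e false false) := by
    have hEm : MeasurableSet {ω | S ω = Sample.e ∧ X ω = x} := (hSm _).inter hXm
    have hE : P.real {ω | S ω = Sample.e ∧ X ω = x} ≠ 0 := by
      refine (measureReal_ne_zero_iff).2 ((positivity_e true true).trans_le (measure_mono ?_)).ne'
      rintro ω ⟨h1, h2, -⟩
      exact ⟨h1, h2⟩
    have key : ∀ A : Set Ω, (P[|{ω | S ω = Sample.e ∧ X ω = x}]).real A =
        (P.real {ω | S ω = Sample.e ∧ X ω = x})⁻¹ * P.real {ω | X ω = x} *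
          Q.real (A ∩ {ω | S ω = Sample.e}) := by
      intro A
      rw [hQ, cond_real_apply hEm, cond_real_apply hXm, mul_assoc, mul_inv_cancel_left₀ hx0]
      congr 2
      ext ω
      simp only [Set.mem_ofPred_eq, Set.mem_inter_iff]
      tauto
    have hD' : ∀ d, (P[|{ω | S ω = Sample.e ∧ X ω = x}]).real {ω | D ω = d} =
        (P.real {ω | S ω = Sample.e ∧ X ω = x})⁻¹ * P.real {ω | X ω = x} *
          (q Sample.e d true + q Sample.e d false) := by
      intro d
      rw [key, ← hmargD]
      rfl
    have hDY' : ∀ d, (P[|{ω | S ω = Sample.e ∧ X ω = x}]).real {ω | D ω = d ∧ Y ω = true} =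
        (P.real {ω | S ω = Sample.e ∧ X ω = x})⁻¹ * P.real {ω | X ω = x} *
          q Sample.e d true := by
      intro d
      rw [key]
      congr 2
      ext ω
      simp only [Set.mem_ofPred_eq, Set.mem_inter_iff]
      tauto
    have hc : (P.real {ω | S ω = Sample.e ∧ X ω = x})⁻¹ * P.real {ω | X ω = x} ≠ 0 :=
      mul_ne_zero (inv_ne_zero hE) hx0
    have hDne : ∀ d, (P[|{ω | S ω = Sample.e ∧ X ω = x}]).real {ω | D ω = d} ≠ 0 := by
      intro d
      rw [hD']
      exact mul_ne_zero hc (add_pos (hqe d true) (hqe d false)).ne'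
    rw [hθx, integral_b2r_sub_eq hY0 hY1 hYdef randomization (hDne true) (hDne false),
      hD', hD', hDY', hDY', mul_div_mul_left _ _ hc, mul_div_mul_left _ _ hc]
  have hind : ∀ (A : Set Ω) (c : ℝ), MeasurableSet A →
      Integrable (fun ω => A.indicator (1 : Ω → ℝ) ω / c) Q ∧
      ∀ B : Set 𝓡, MeasurableSet B →
        ∫ ω in R ⁻¹' B, A.indicator (1 : Ω → ℝ) ω / c ∂Q = Q.real (A ∩ R ⁻¹' B) / c := by
    intro A c hA
    refine ⟨((integrable_const (1 : ℝ)).indicator hA).div_const c, fun B hB => ?_⟩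
    rw [integral_div, integral_indicator_one hA, measureReal_restrict_apply hA]
  have hDSm : ∀ d s, MeasurableSet {ω | D ω = d ∧ S ω = s} := fun d s => (hDm d).inter (hSm s)
  have hYSm : ∀ y s, MeasurableSet {ω | Y ω = y ∧ S ω = s} := fun y s => (hYm y).inter (hSm s)
  have hf : (fun ω => Δe ω - θx * Δo ω) = fun ω =>
      ({ω | D ω = true ∧ S ω = Sample.e}.indicator (1 : Ω → ℝ) ω /
          (q Sample.e true true + q Sample.e true false) -
        {ω | D ω = false ∧ S ω = Sample.e}.indicator (1 : Ω → ℝ) ω /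
          (q Sample.e false true + q Sample.e false false)) -
      θx * ({ω | Y ω = true ∧ S ω = Sample.o}.indicator (1 : Ω → ℝ) ω /
          (q Sample.o true true + q Sample.o false true) -
        {ω | Y ω = false ∧ S ω = Sample.o}.indicator (1 : Ω → ℝ) ω /
          (q Sample.o true false + q Sample.o false false)) := by
    ext ω
    rw [hΔe, hΔo, ← hmargD, ← hmargD, ← hmargY, ← hmargY]
    simp only [Set.indicator, Set.mem_ofPred_eq, Pi.one_apply, measureReal_def]
  have i1 := hind _ (q Sample.e true true + q Sample.e true false) (hDSm true Sample.e)
  have i2 := hind _ (q Sample.e false true + q Sample.e false false) (hDSm false Sample.e)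
  have i3 := hind _ (q Sample.o true true + q Sample.o false true) (hYSm true Sample.o)
  have i4 := hind _ (q Sample.o true false + q Sample.o false false) (hYSm false Sample.o)
  have hsub : ∀ {f g : Ω → ℝ}, Integrable f Q → Integrable g Q →
      Integrable (fun ω => f ω - g ω) Q := fun h1 h2 => h1.sub h2
  have j1 := hsub i1.1 i2.1
  have j2 := hsub i3.1 i4.1
  rw [hf]
  symm
  refine ae_eq_condExp_of_forall_setIntegral_eq hR.comap_le
    (j1.sub (j2.const_mul θx)) (fun _ _ _ => integrableOn_zero) ?_
    aestronglyMeasurable_zero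
  rintro _ ⟨B, hB, rfl⟩ -
  rw [integral_sub j1.integrableOn (j2.const_mul θx).integrableOn,
    integral_const_mul, integral_sub i1.1.integrableOn i2.1.integrableOn,
    integral_sub i3.1.integrableOn i4.1.integrableOn, i1.2 B hB, i2.2 B hB, i3.2 B hB, i4.2 B hB,
    hsplitY _ B hB, hsplitY _ B hB, hsplitD _ B hB, hsplitD _ B hB, hθ]
  have n1 := (add_pos (hqe true true) (hqe true false)).ne'
  have n2 := (add_pos (hqe false true) (hqe false false)).ne'
  rw [mul_div_cancel_left₀ _ (hqo true).ne', mul_div_cancel_left₀ _ (hqo false).ne']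
  simp only [Pi.zero_apply, integral_zero]
  field_simp
  ring
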